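/- arXiv:2511.07167 — 2 statements merged into one kernel-verified Lean document; each statement's English description precedes it below -/
import Mathlib

section
/- Let (K, d) be a nonempty compact metric space, u : K → ℝ upper semicontinuous, v : K → ℝ lower semicontinuous, and set M := sup_{x ∈ K} (u(x) − v(x)) (finite by compactness and semicontinuity). For each ε > 0 let (x_ε, y_ε) ∈ K × K be a maximizer of the penalized function Φ_ε(x,y) = u(x) − v(y) − d(x,y)²/(2ε²) (such a maximizer exists since Φ_ε is upper semicontinuous on the compact K × K). Then as ε → 0: (i) the penalty vanishes, d(x_ε, y_ε)²/(2ε²) → 0; (ii) d(x_ε, y_ε) → 0; and (iii) u(x_ε) − v(y_ε) → M. -/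
open Filter Topology

/-- **Doubling of variables: behaviour of penalized maximizers as `ε → 0`.**
Let `K` be a nonempty compact metric space, `u` upper semicontinuous, `v`
lower semicontinuous, and `M = sup_{x∈K} (u(x) − v(x))`. If for each `ε > 0`
the pair `(x_ε, y_ε)` maximizes `Φ_ε(p,q) = u(p) − v(q) − d(p,q)²/(2ε²)`, then
as `ε → 0`: (i) `d(x_ε,y_ε)²/(2ε²) → 0`; (ii) `d(x_ε,y_ε) → 0`;
(iii) `u(x_ε) − v(y_ε) → M`. -/
theorem doubling_variables_penalization {K : Type*} [MetricSpace K]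
    [CompactSpace K] [Nonempty K] (u v : K → ℝ)
    (hu : UpperSemicontinuous u) (hv : LowerSemicontinuous v)
    (M : ℝ) (hM : M = sSup (Set.range fun p => u p - v p))
    (x y : ℝ → K)
    (hmax : ∀ ε : ℝ, 0 < ε → ∀ p q : K,
      u p - v q - dist p q ^ 2 / (2 * ε ^ 2)
        ≤ u (x ε) - v (y ε) - dist (x ε) (y ε) ^ 2 / (2 * ε ^ 2)) :
    Tendsto (fun ε : ℝ => dist (x ε) (y ε) ^ 2 / (2 * ε ^ 2))
        (𝓝[>] (0 : ℝ)) (𝓝 0) ∧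
    Tendsto (fun ε : ℝ => dist (x ε) (y ε)) (𝓝[>] (0 : ℝ)) (𝓝 0) ∧
    Tendsto (fun ε : ℝ => u (x ε) - v (y ε)) (𝓝[>] (0 : ℝ)) (𝓝 M) := by
  obtain ⟨a, -, ha⟩ := UpperSemicontinuousOn.exists_isMaxOn Set.univ_nonempty isCompact_univ
    (hu.upperSemicontinuousOn Set.univ)
  obtain ⟨b, -, hb⟩ := LowerSemicontinuousOn.exists_isMinOn Set.univ_nonempty isCompact_univ
    (hv.lowerSemicontinuousOn Set.univ)
  have ha : ∀ p, u p ≤ u a := fun p => ha (Set.mem_univ p)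
  have hb : ∀ p, v b ≤ v p := fun p => hb (Set.mem_univ p)
  have hle : ∀ p, u p - v p ≤ M := by
    intro p
    rw [hM]
    refine le_csSup ⟨u a - v b, ?_⟩ ⟨p, rfl⟩
    rintro _ ⟨q, rfl⟩
    have h1 := ha q
    have h2 := hb q
    show u q - v q ≤ _
    linarith
  have hlow : ∀ ε : ℝ, 0 < ε →
      M ≤ u (x ε) - v (y ε) - dist (x ε) (y ε) ^ 2 / (2 * ε ^ 2) := by
    intro ε hε
    rw [hM]
    refine csSup_le (Set.range_nonempty _) ?_
    rintro _ ⟨q, rfl⟩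
    simpa using hmax ε hε q q
  have hdist : Tendsto (fun ε : ℝ => dist (x ε) (y ε)) (𝓝[>] (0 : ℝ)) (𝓝 0) := by
    have h0 : Tendsto (fun ε : ℝ => √(2 * ε ^ 2 * (u a - v b - M))) (𝓝[>] (0 : ℝ)) (𝓝 0) := by
      have hc : Continuous (fun ε : ℝ => √(2 * ε ^ 2 * (u a - v b - M))) := by fun_prop
      have := hc.tendsto 0
      simp only [ne_eq, OfNat.ofNat_ne_zero, not_false_eq_true, zero_pow, mul_zero, zero_mul,
        Real.sqrt_zero] at this
      exact this.mono_left nhdsWithin_le_nhds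
    refine squeeze_zero' (Eventually.of_forall fun _ => dist_nonneg) ?_ h0
    filter_upwards [self_mem_nhdsWithin] with ε hε
    have hε : 0 < ε := hε
    apply Real.le_sqrt_of_sq_le
    have h1 := hlow ε hε
    have h2 := ha (x ε)
    have h3 := hb (y ε)
    have h4 : dist (x ε) (y ε) ^ 2 / (2 * ε ^ 2) ≤ u a - v b - M := by linarith
    rw [div_le_iff₀ (by positivity)] at h4
    linarith
  have hup : ∀ δ : ℝ, 0 < δ → ∀ᶠ ε in 𝓝[>] (0 : ℝ), u (x ε) - v (y ε) < M + δ := by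
    intro δ hδ
    have hS : {w : K × K | u w.1 - v w.2 < M + δ} ∈ uniformity K := by
      rw [compactSpace_uniformity, mem_iSup]
      intro z
      rw [nhds_prod_eq]
      have h1 := hu z (u z + δ / 2) (by linarith)
      have h2 := hv z (v z - δ / 2) (by linarith)
      filter_upwards [h1.prod_mk h2] with w hw
      have h3 := hle z
      have h4 := hw.1
      have h5 := hw.2
      show u w.1 - v w.2 < M + δ
      linarith
    obtain ⟨r, hr, hrS⟩ := Metric.mem_uniformity_dist.1 hS
    filter_upwards [hdist.eventually (gt_mem_nhds hr)] with ε hε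
    exact hrS hε
  refine ⟨?_, hdist, ?_⟩
  · rw [tendsto_order]
    constructor
    · intro c hc
      exact Eventually.of_forall fun ε => lt_of_lt_of_le hc (by positivity)
    · intro c hc
      filter_upwards [hup c hc, self_mem_nhdsWithin] with ε h1 h2
      have h3 := hlow ε h2
      linarith
  · rw [tendsto_order]
    constructor
    · intro c hc
      filter_upwards [self_mem_nhdsWithin] with ε h2
      have h3 := hlow ε h2
      have h4 : 0 ≤ dist (x ε) (y ε) ^ 2 / (2 * ε ^ 2) := by positivity
      linarith
    · intro c hc
      filter_upwards [hup (c - M) (by linarith)] with ε h1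
      linarith
end

section
/- Let (K, d) be a nonempty compact metric space, u : K → ℝ upper semicontinuous, v : K → ℝ lower semicontinuous, and M := sup_{x ∈ K} (u(x) − v(x)). Let ε_n → 0 be a sequence of positive numbers and let (x_n, y_n) ∈ K × K maximize Φ_{ε_n}(x,y) = u(x) − v(y) − d(x,y)²/(2ε_n²) over K × K. If x_n converges to some point x̂ ∈ K, then y_n also converges to x̂, and x̂ attains the supremum: u(x̂) − v(x̂) = M. In particular, the supremum of u − v over K is attained, and every cluster point of the penalized maximizers is a maximizer of u − v. -/
open Filter Topology

/-- **Doubling of variables: cluster points of penalized maximizers attain the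
supremum.** Let `K` be a nonempty compact metric space, `u` USC, `v` LSC and
`M = sup_{x∈K}(u(x) − v(x))`. Let `ε_n → 0` with `ε_n > 0`, and let
`(x_n, y_n)` maximize `Φ_{ε_n}(p,q) = u(p) − v(q) − d(p,q)²/(2ε_n²)` over
`K × K`. If `x_n → xhat`, then also `y_n → xhat` and `u(xhat) − v(xhat) = M`; in
particular the supremum of `u − v` is attained at `xhat`. -/
theorem doubling_variables_cluster_point {K : Type*} [MetricSpace K]
    [CompactSpace K] [Nonempty K] (u v : K → ℝ)
    (hu : UpperSemicontinuous u) (hv : LowerSemicontinuous v)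
    (M : ℝ) (hM : M = sSup (Set.range fun p => u p - v p))
    (ε : ℕ → ℝ) (hε : ∀ n, 0 < ε n) (hεlim : Tendsto ε atTop (𝓝 0))
    (x y : ℕ → K)
    (hmax : ∀ n : ℕ, ∀ p q : K,
      u p - v q - dist p q ^ 2 / (2 * ε n ^ 2)
        ≤ u (x n) - v (y n) - dist (x n) (y n) ^ 2 / (2 * ε n ^ 2))
    (xhat : K) (hx : Tendsto x atTop (𝓝 xhat)) :
    Tendsto y atTop (𝓝 xhat) ∧ u xhat - v xhat = M := by
  obtain ⟨a, -, ha⟩ := (hu.upperSemicontinuousOn Set.univ).exists_isMaxOn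
    Set.univ_nonempty isCompact_univ
  obtain ⟨b, -, hb⟩ := (hv.lowerSemicontinuousOn Set.univ).exists_isMinOn
    Set.univ_nonempty isCompact_univ
  have ha' : ∀ p, u p ≤ u a := fun p => ha (Set.mem_univ p)
  have hb' : ∀ p, v b ≤ v p := fun p => hb (Set.mem_univ p)
  have hdiag : ∀ n p, u p - v p
      ≤ u (x n) - v (y n) - dist (x n) (y n) ^ 2 / (2 * ε n ^ 2) := by
    intro n p
    have h := hmax n p p
    simpa using h
  have hsq : Tendsto (fun n => dist (x n) (y n) ^ 2) atTop (𝓝 0) := by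
    have hlim : Tendsto (fun n => (u a - v b - (u a - v a)) * (2 * ε n ^ 2)) atTop (𝓝 0) := by
      have h := ((hεlim.pow 2).const_mul 2).const_mul (u a - v b - (u a - v a))
      simpa using h
    refine squeeze_zero (fun n => sq_nonneg _) (fun n => ?_) hlim
    have hpos : 0 < 2 * ε n ^ 2 := by have := hε n; positivity
    rw [← div_le_iff₀ hpos]
    linarith [hdiag n a, ha' (x n), hb' (y n)]
  have hd : Tendsto (fun n => dist (x n) (y n)) atTop (𝓝 0) := by
    have h := hsq.sqrt
    simpa [Real.sqrt_sq dist_nonneg] using h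
  have hy : Tendsto y atTop (𝓝 xhat) := (tendsto_iff_of_dist hd).1 hx
  refine ⟨hy, ?_⟩
  have key : ∀ p, u p - v p ≤ u xhat - v xhat := by
    intro p
    refine le_of_forall_pos_le_add fun δ hδ => ?_
    have h1 := hx.eventually (hu xhat (u xhat + δ / 2) (by linarith))
    have h2 := hy.eventually (hv xhat (v xhat - δ / 2) (by linarith))
    obtain ⟨n, h1, h2⟩ := (h1.and h2).exists
    have h3 : 0 ≤ dist (x n) (y n) ^ 2 / (2 * ε n ^ 2) := by positivity
    linarith [hdiag n p]
  have hg : IsGreatest (Set.range fun p => u p - v p) (u xhat - v xhat) :=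
    ⟨⟨xhat, rfl⟩, by rintro _ ⟨p, rfl⟩; exact key p⟩
  rw [hM, hg.csSup_eq]
end
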